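/- Let α ∈ (0,2] and let x ∈ S². Then the function y ↦ ‖x − y‖^{α−2} is integrable on S² with respect to the surface measure σ, and ∫_{S²} ‖x − y‖^{α−2} dσ(y) = 2^{α+1}·π/α. -/

import Mathlib

open MeasureTheory

/-- `E3` is the Euclidean space `ℝ³`. -/
noncomputable abbrev E3 : Type := EuclideanSpace ℝ (Fin 3)

/-- `S2` is the unit sphere in `ℝ³`. -/
noncomputable abbrev S2 : Type := Metric.sphere (0 : E3) 1

/-- The surface measure `σ` on `S²` (of total mass `4π`). -/
noncomputable def surfaceMeasure : Measure S2 := (volume : Measure E3).toSphere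

open Set Metric Real
open scoped ENNReal

/-- Integration in polar coordinates of a function which is homogeneous of degree zero, over the
unit ball. -/
theorem lintegral_toSphere_inner {E : Type*} [NormedAddCommGroup E] [InnerProductSpace ℝ E]
    [MeasurableSpace E] [BorelSpace E] [FiniteDimensional ℝ E] [Nontrivial E]
    (μ : Measure E) [μ.IsAddHaarMeasure] (x : E) {g : ℝ → ℝ≥0∞} (hg : Measurable g) :
    ∫⁻ y, g (inner ℝ x (y : E)) ∂μ.toSphere =
      Module.finrank ℝ E *
        ∫⁻ z, (Iio (1 : ℝ)).indicator 1 ‖z‖ * g (inner ℝ x z / ‖z‖) ∂μ := by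
  have hdim : 0 < Module.finrank ℝ E := Module.finrank_pos
  have hcongr : ∫⁻ z, (Iio (1 : ℝ)).indicator 1 ‖z‖ * g (inner ℝ x z / ‖z‖) ∂μ =
      ∫⁻ p : sphere (0 : E) 1 × Ioi (0 : ℝ),
        g (inner ℝ x (p.1 : E)) * (Iio (⟨1, mem_Ioi.2 one_pos⟩ : Ioi (0 : ℝ))).indicator 1 p.2
          ∂(μ.toSphere.prod (Measure.volumeIoiPow (Module.finrank ℝ E - 1))) := by
    rw [← μ.measurePreserving_homeomorphUnitSphereProd.lintegral_comp_emb
        (Homeomorph.measurableEmbedding _), ← setLIntegral_univ (μ := μ),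
      ← setLIntegral_congr (μ := μ) (s := {0}ᶜ) (by simp [ae_eq_univ]),
      ← lintegral_subtype_comap (measurableSet_singleton (0 : E)).compl]
    refine lintegral_congr fun z => ?_
    rw [mul_comm]
    congr 1
    · simp [real_inner_smul_right, div_eq_inv_mul]
    · simp [indicator, ← Subtype.coe_lt_coe]
  rw [hcongr, lintegral_prod_mul (f := fun y : sphere (0 : E) 1 => g (inner ℝ x (y : E)))
    (by fun_prop) (measurable_one.indicator measurableSet_Iio).aemeasurable,
    lintegral_indicator_one measurableSet_Iio, Measure.volumeIoiPow_apply_Iio, mul_left_comm,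
    ← ENNReal.ofReal_natCast, ← ENNReal.ofReal_mul (by positivity)]
  have : ((Module.finrank ℝ E : ℕ) : ℝ) ≠ 0 := by positivity
  simp [Nat.cast_pred hdim, this]

/-- Two-dimensional integral of a radial function. -/
theorem lintegral_radial_prod {f : ℝ → ℝ≥0∞} (hf : Measurable f) :
    ∫⁻ q : ℝ × ℝ, f (q.1 ^ 2 + q.2 ^ 2) =
      ENNReal.ofReal (2 * π) * ∫⁻ ρ in Ioi 0, ENNReal.ofReal ρ * f (ρ ^ 2) := by
  rw [← lintegral_comp_polarCoord_symm]
  have h : ∀ p : ℝ × ℝ, ENNReal.ofReal p.1 •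
      f ((polarCoord.symm p).1 ^ 2 + (polarCoord.symm p).2 ^ 2) =
      (ENNReal.ofReal p.1 * f (p.1 ^ 2)) * (1 : ℝ → ℝ≥0∞) p.2 := by
    intro p
    simp only [polarCoord_symm_apply, smul_eq_mul, Pi.one_apply, mul_one]
    congr 2
    linear_combination p.1 ^ 2 * Real.sin_sq_add_cos_sq p.2
  simp_rw [h]
  rw [polarCoord_target, Measure.volume_eq_prod, ← Measure.prod_restrict,
    lintegral_prod_mul (f := fun r : ℝ => ENNReal.ofReal r * f (r ^ 2)) (by fun_prop)
      (by fun_prop), mul_comm]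
  simp [two_mul]

/-- Integral over `ℝ³` of a function of the norm and of one coordinate, in spherical
coordinates. -/
theorem lintegral_inner_norm {x : E3} (hx : ‖x‖ = 1) {F : ℝ × ℝ → ℝ≥0∞} (hF : Measurable F) :
    ∫⁻ z : E3, F (inner ℝ x z, ‖z‖) =
      ENNReal.ofReal (2 * π) * ∫⁻ p in Ioi (0 : ℝ) ×ˢ Ioo 0 π,
        ENNReal.ofReal (p.1 ^ 2 * sin p.2) * F (p.1 * cos p.2, p.1) := by
  obtain ⟨b, hb⟩ : ∃ b : OrthonormalBasis (Fin 3) ℝ E3, b 0 = x := by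
    have hv : Orthonormal ℝ (({0} : Set (Fin 3)).domRestrict fun _ => x) :=
      ⟨fun _ => hx, fun i j hij => (hij (Subsingleton.elim i j)).elim⟩
    obtain ⟨b, hb⟩ := hv.exists_orthonormalBasis_extension_of_card_eq (by simp)
    exact ⟨b, hb 0 rfl⟩
  have hcoord : ∫⁻ z : E3, F (inner ℝ x z, ‖z‖) =
      ∫⁻ p : ℝ × ℝ × ℝ, F (p.1, √(p.1 ^ 2 + (p.2.1 ^ 2 + p.2.2 ^ 2))) := by
    have hmp := (((MeasurePreserving.id (volume : Measure ℝ)).prod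
      (volume_preserving_finTwoArrow ℝ)).comp
      (volume_preserving_piFinSuccAbove (fun _ : Fin 3 => ℝ) 0)).comp
      ((PiLp.volume_preserving_ofLp (Fin 3)).comp b.measurePreserving_repr)
    rw [Measure.volume_eq_prod ℝ (ℝ × ℝ), ← hmp.lintegral_comp (by fun_prop)]
    refine lintegral_congr fun z => ?_
    have h0 : b.repr z 0 = inner ℝ x z := by rw [b.repr_apply_apply, hb]
    have hn : ‖z‖ = √(b.repr z 0 ^ 2 + (b.repr z 1 ^ 2 + b.repr z 2 ^ 2)) := by
      rw [← b.repr.norm_map z, EuclideanSpace.norm_eq]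
      simp [Fin.sum_univ_three, add_assoc]
    rw [← h0, hn]
    rfl
  have hplane : ∀ s : ℝ, ∫⁻ q : ℝ × ℝ, F (s, √(s ^ 2 + (q.1 ^ 2 + q.2 ^ 2))) =
      ENNReal.ofReal (2 * π) *
        ∫⁻ ρ in Ioi 0, ENNReal.ofReal ρ * F (s, √(s ^ 2 + ρ ^ 2)) := fun s =>
    lintegral_radial_prod (f := fun v => F (s, √(s ^ 2 + v))) (by fun_prop)
  have hmeas : Measurable fun p : ℝ × ℝ =>
      (Ioi (0 : ℝ)).indicator (fun ρ => ENNReal.ofReal ρ * F (p.1, √(p.1 ^ 2 + ρ ^ 2))) p.2 := by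
    have : Measurable fun p : ℝ × ℝ => ENNReal.ofReal p.2 * F (p.1, √(p.1 ^ 2 + p.2 ^ 2)) := by
      fun_prop
    exact this.indicator (measurable_snd measurableSet_Ioi)
  rw [hcoord, Measure.volume_eq_prod, lintegral_prod _ (by fun_prop)]
  simp_rw [hplane, ← lintegral_indicator measurableSet_Ioi]
  rw [lintegral_const_mul _ hmeas.lintegral_prod_right', ← lintegral_prod _ hmeas.aemeasurable,
    ← Measure.volume_eq_prod, ← lintegral_comp_polarCoord_symm, polarCoord_target]
  congr 1
  rw [← lintegral_indicator (measurableSet_Ioi.prod measurableSet_Ioo),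
    ← lintegral_indicator (measurableSet_Ioi.prod measurableSet_Ioo)]
  refine lintegral_congr fun ⟨r, θ⟩ => ?_
  simp only [indicator, mem_prod, mem_Ioi, mem_Ioo, polarCoord_symm_apply]
  by_cases hr : 0 < r
  swap
  · simp [hr]
  by_cases hθ : 0 < θ ∧ θ < π
  · have hs := sin_pos_of_pos_of_lt_pi hθ.1 hθ.2
    have hsq : (r * cos θ) ^ 2 + (r * sin θ) ^ 2 = r ^ 2 := by
      linear_combination r ^ 2 * Real.sin_sq_add_cos_sq θ
    have h1 : -π < θ := by linarith [hθ.1, pi_pos]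
    simp only [hr, hθ, h1, mul_pos hr hs, and_self, if_true, hsq, sqrt_sq hr.le, smul_eq_mul]
    rw [← mul_assoc, ← ENNReal.ofReal_mul hr.le]
    ring_nf
  · rw [if_neg (c := 0 < r ∧ 0 < θ ∧ θ < π) (by tauto)]
    split_ifs with h1 h2
    · have : θ ≤ 0 := by
        by_contra! h
        exact hθ ⟨h, h1.2.2⟩
      have := sin_nonpos_of_nonpos_of_neg_pi_le this h1.2.1.le
      exact absurd h2 (by nlinarith)
    · simp
    · rfl

/-- Archimedes' hat-box theorem in angular form. -/
theorem lintegral_surfaceMeasure_inner (x : S2) {g : ℝ → ℝ≥0∞} (hg : Measurable g) :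
    ∫⁻ y, g (inner ℝ (x : E3) (y : E3)) ∂surfaceMeasure =
      ENNReal.ofReal (2 * π) * ∫⁻ θ in Ioo 0 π, ENNReal.ofReal (sin θ) * g (cos θ) := by
  have hx : ‖(x : E3)‖ = 1 := by simp
  have hind : Measurable ((Iio (1 : ℝ)).indicator (1 : ℝ → ℝ≥0∞)) :=
    measurable_one.indicator measurableSet_Iio
  have hr : ∫⁻ r in Ioi (0 : ℝ), ENNReal.ofReal (r ^ 2) * (Iio (1 : ℝ)).indicator 1 r =
      ENNReal.ofReal (1 / 3) := by
    have h : ∀ r : ℝ, ENNReal.ofReal (r ^ 2) * (Iio (1 : ℝ)).indicator 1 r =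
        (Iio (1 : ℝ)).indicator (fun r => ENNReal.ofReal (r ^ 2)) r := by
      intro r
      by_cases h : r < 1 <;> simp [h]
    simp_rw [h]
    rw [lintegral_indicator measurableSet_Iio, Measure.restrict_restrict measurableSet_Iio,
      inter_comm, Ioi_inter_Iio, restrict_Ioo_eq_restrict_Ioc,
      ← ofReal_integral_eq_lintegral_ofReal
      (intervalIntegral.intervalIntegrable_pow 2).1 (ae_of_all _ fun r => sq_nonneg r),
      ← intervalIntegral.integral_of_le zero_le_one, integral_pow]
    norm_num
  rw [surfaceMeasure, lintegral_toSphere_inner _ _ hg,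
    lintegral_inner_norm hx (F := fun p => (Iio (1 : ℝ)).indicator 1 p.2 * g (p.1 / p.2))
      (by fun_prop)]
  have hsplit : ∫⁻ p in Ioi (0 : ℝ) ×ˢ Ioo 0 π, ENNReal.ofReal (p.1 ^ 2 * sin p.2) *
        ((Iio (1 : ℝ)).indicator 1 p.1 * g (p.1 * cos p.2 / p.1)) =
      ∫⁻ p in Ioi (0 : ℝ) ×ˢ Ioo 0 π,
        (ENNReal.ofReal (p.1 ^ 2) * (Iio (1 : ℝ)).indicator 1 p.1) *
          (ENNReal.ofReal (sin p.2) * g (cos p.2)) := by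
    refine setLIntegral_congr_fun (measurableSet_Ioi.prod measurableSet_Ioo) fun p hp => ?_
    have hp1 : p.1 ≠ 0 := (mem_Ioi.1 hp.1).ne'
    simp only [mul_div_cancel_left₀ _ hp1]
    rw [ENNReal.ofReal_mul (sq_nonneg _)]
    ring
  rw [hsplit, Measure.volume_eq_prod, ← Measure.prod_restrict,
    lintegral_prod_mul
      (f := fun r : ℝ => ENNReal.ofReal (r ^ 2) * (Iio (1 : ℝ)).indicator 1 r)
      (g := fun θ => ENNReal.ofReal (sin θ) * g (cos θ)) (by fun_prop) (by fun_prop), hr,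
    finrank_euclideanSpace_fin, ← ENNReal.ofReal_natCast, ← mul_assoc, ← mul_assoc,
    ← ENNReal.ofReal_mul (by positivity), ← ENNReal.ofReal_mul (by positivity)]
  congr 2
  push_cast
  ring

theorem lintegral_sin_mul_two_sub_two_cos_rpow {α : ℝ} (hα : 0 < α) :
    ∫⁻ θ in Ioo 0 π, ENNReal.ofReal (sin θ) *
      ENNReal.ofReal ((2 - 2 * cos θ) ^ ((α - 2) / 2)) = ENNReal.ofReal (2 ^ α / α) := by
  have hpos : ∀ θ ∈ Ioo 0 π, 0 < 2 - 2 * cos θ := fun θ hθ => by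
    have := cos_lt_cos_of_nonneg_of_le_pi le_rfl hθ.2.le hθ.1
    rw [cos_zero] at this
    linarith
  have hcont : ContinuousOn (fun θ => (2 - 2 * cos θ) ^ (α / 2) / α) (Icc 0 π) :=
    ((Continuous.rpow_const (by fun_prop) fun _ => Or.inr (by positivity)).div_const _).continuousOn
  have hderiv : ∀ θ ∈ Ioo 0 π, HasDerivAt (fun θ => (2 - 2 * cos θ) ^ (α / 2) / α)
      (sin θ * (2 - 2 * cos θ) ^ ((α - 2) / 2)) θ := fun θ hθ => by
    have h1 : HasDerivAt (fun θ => 2 - 2 * cos θ) (2 * sin θ) θ := by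
      simpa using ((hasDerivAt_cos θ).const_mul 2).const_sub 2
    refine ((h1.rpow_const (p := α / 2) (Or.inl (hpos θ hθ).ne')).div_const α).congr_deriv ?_
    rw [show (α - 2) / 2 = α / 2 - 1 by ring]
    field_simp
  have hnonneg : ∀ θ ∈ Ioo 0 π, 0 ≤ sin θ * (2 - 2 * cos θ) ^ ((α - 2) / 2) := fun θ hθ =>
    mul_nonneg (sin_pos_of_pos_of_lt_pi hθ.1 hθ.2).le (rpow_nonneg (hpos θ hθ).le _)
  have hint := intervalIntegral.integrableOn_deriv_of_nonneg hcont hderiv hnonneg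
  calc
    _ = ∫⁻ θ in Ioo 0 π, ENNReal.ofReal (sin θ * (2 - 2 * cos θ) ^ ((α - 2) / 2)) :=
      setLIntegral_congr_fun measurableSet_Ioo fun θ hθ =>
        (ENNReal.ofReal_mul (sin_pos_of_pos_of_lt_pi hθ.1 hθ.2).le).symm
    _ = ENNReal.ofReal (∫ θ in Ioo 0 π, sin θ * (2 - 2 * cos θ) ^ ((α - 2) / 2)) :=
      (ofReal_integral_eq_lintegral_ofReal (hint.mono_set Ioo_subset_Ioc_self)
        (ae_restrict_of_forall_mem measurableSet_Ioo hnonneg)).symm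
    _ = ENNReal.ofReal (2 ^ α / α) := by
      rw [← integral_Ioc_eq_integral_Ioo, ← intervalIntegral.integral_of_le pi_pos.le,
        intervalIntegral.integral_eq_sub_of_hasDerivAt_of_le pi_pos.le hcont hderiv
          ((intervalIntegrable_iff_integrableOn_Ioc_of_le pi_pos.le).2 hint)]
      have h4 : (2 - 2 * cos π) ^ (α / 2) = (2 : ℝ) ^ α := by
        rw [cos_pi, show (2 - 2 * -1 : ℝ) = 2 ^ (2 : ℝ) by norm_num,
          ← rpow_mul zero_le_two]
        ring_nf
      rw [h4, cos_zero, mul_one, sub_self, zero_rpow (by positivity), zero_div, sub_zero]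

theorem norm_sub_rpow_eq_inner (x y : S2) (β : ℝ) :
    ‖(x : E3) - (y : E3)‖ ^ β = (2 - 2 * inner ℝ (x : E3) (y : E3)) ^ (β / 2) := by
  have h : 2 - 2 * inner ℝ (x : E3) (y : E3) = ‖(x : E3) - (y : E3)‖ ^ (2 : ℝ) := by
    rw [rpow_two, norm_sub_sq_real, norm_eq_of_mem_sphere x, norm_eq_of_mem_sphere y]
    ring
  rw [h, ← rpow_mul (norm_nonneg _)]
  ring_nf

/-- Let `α ∈ (0,2]` and `x ∈ S²`.  Then `y ↦ ‖x − y‖^{α−2}` is integrable on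
`S²` with respect to the surface measure `σ`, and
`∫_{S²} ‖x − y‖^{α−2} dσ(y) = 2^{α+1}·π/α`. -/
theorem stmt_13 (α : ℝ) (hα : α ∈ Set.Ioc (0 : ℝ) 2) (x : S2) :
    Integrable (fun y : S2 => ‖(x : E3) - (y : E3)‖ ^ (α - 2)) surfaceMeasure ∧
      ∫ y : S2, ‖(x : E3) - (y : E3)‖ ^ (α - 2) ∂surfaceMeasure =
        2 ^ (α + 1) * Real.pi / α := by
  have hlint : ∫⁻ y : S2, ENNReal.ofReal (‖(x : E3) - (y : E3)‖ ^ (α - 2)) ∂surfaceMeasure =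
      ENNReal.ofReal (2 ^ (α + 1) * Real.pi / α) := by
    simp_rw [norm_sub_rpow_eq_inner]
    rw [lintegral_surfaceMeasure_inner x
      (g := fun c => ENNReal.ofReal ((2 - 2 * c) ^ ((α - 2) / 2))) (by fun_prop),
      lintegral_sin_mul_two_sub_two_cos_rpow hα.1, ← ENNReal.ofReal_mul (by positivity),
      rpow_add_one two_ne_zero]
    ring_nf
  have hnonneg : ∀ y : S2, 0 ≤ ‖(x : E3) - (y : E3)‖ ^ (α - 2) := fun y => by positivity
  have hmeas : Measurable fun y : S2 => ‖(x : E3) - (y : E3)‖ ^ (α - 2) := by fun_prop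
  have hα' := hα.1
  refine ⟨⟨hmeas.aestronglyMeasurable, ?_⟩, ?_⟩
  · rw [hasFiniteIntegral_iff_ofReal (ae_of_all _ hnonneg), hlint]
    exact ENNReal.ofReal_lt_top
  · rw [integral_eq_lintegral_of_nonneg_ae (ae_of_all _ hnonneg) hmeas.aestronglyMeasurable,
      hlint, ENNReal.toReal_ofReal (by positivity)]
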